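/- For all polynomials m₁, m₂ ∈ ℚ[X], one has the identity m̂₁ · m̂₂ = (m₁ ∧ m₂)^∧ · 1̂ in the field of formal Laurent series ℚ((u)), where (m₁ ∧ m₂)^∧ denotes the hat transform of the polynomial m₁ ∧ m₂ and 1̂ = 1/(2s) + 1/2 is the hat transform of the constant polynomial 1. -/

import Mathlib

open Polynomial

/-- The formula for `ℳ(Xⁿ) = ∑_{k=0}^{⌊n/2⌋} (−1)^k · C(n−k, k) · X^{n−k}`. -/
noncomputable def Mform (n : ℕ) : Polynomial ℚ :=
  ∑ k ∈ Finset.range (n / 2 + 1),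
    Polynomial.C ((-1 : ℚ) ^ k * (Nat.choose (n - k) k : ℚ)) * Polynomial.X ^ (n - k)

/-- The formula for `𝒯(Xⁿ) = ∑_{k=1}^{n} (k/(2n−k)) · C(2n−k, n−k) · X^k` (for `n ≥ 1`). -/
noncomputable def Tform (n : ℕ) : Polynomial ℚ :=
  ∑ k ∈ Finset.Icc 1 n,
    Polynomial.C ((k : ℚ) / ((2 * n - k : ℕ) : ℚ) * (Nat.choose (2 * n - k) (n - k) : ℚ)) *
      Polynomial.X ^ k

/-- The Laurent series `m(u⁻¹)` associated to a polynomial `m` (thinking of `u` as `x⁻¹`). -/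
noncomputable def polyInv (m : Polynomial ℚ) : LaurentSeries ℚ :=
  m.sum fun i a => HahnSeries.single (-(i : ℤ)) a

/-- Truncation `[f]` of a Laurent series in `u` to the terms with exponents `≤ 0` in `u`
(i.e. the terms with nonnegative powers of `x = u⁻¹`). -/
noncomputable def truncNonpos (f : LaurentSeries ℚ) : LaurentSeries ℚ where
  coeff n := if n ≤ 0 then f.coeff n else 0
  isPWO_support' := f.isPWO_support'.mono (by
    intro n hn
    simp only [Function.mem_support, ne_eq] at hn ⊢
    intro h
    apply hn
    split <;> simp [h])

/-- The power series `s = 1 − 2·∑_{n≥1} catalan(n−1) uⁿ`, the unique power series with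
constant term `1` whose square is `1 − 4u` (it represents `√(1 − 4/x)`). -/
noncomputable def sSeries : PowerSeries ℚ :=
  1 - 2 * PowerSeries.mk fun n => if n = 0 then 0 else (catalan (n - 1) : ℚ)

/-- `s` viewed as a Laurent series. -/
noncomputable def sL : LaurentSeries ℚ := HahnSeries.ofPowerSeries ℤ ℚ sSeries

/-- The hat transform `m̂ = (1/s)·[m(u⁻¹)·s/2] + m(u⁻¹)/2 ∈ ℚ((u))` of a polynomial `m`. -/
noncomputable def hatX (m : Polynomial ℚ) : LaurentSeries ℚ :=
  (1 / sL) * truncNonpos (polyInv m * sL / 2) + polyInv m / 2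

theorem coeff_Mform (n i : ℕ) :
    (Mform n).coeff i = if i ≤ n then (-1 : ℚ) ^ (n - i) * ((i.choose (n - i) : ℕ) : ℚ) else 0 := by
  unfold Mform
  simp only [finsetSum_coeff, coeff_C_mul, coeff_X_pow, mul_ite, mul_one, mul_zero]
  split_ifs with h
  · by_cases h2 : n - i ≤ n / 2
    · rw [Finset.sum_eq_single (n - i)]
      · rw [if_pos (by omega), show n - (n - i) = i by omega]
      · intro b hb hne
        rw [Finset.mem_range] at hb
        exact if_neg (by omega)
      · intro hb
        exact absurd (Finset.mem_range.2 (by omega)) hb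
    · rw [Nat.choose_eq_zero_of_lt (by omega), Nat.cast_zero, mul_zero]
      refine Finset.sum_eq_zero fun b hb => if_neg ?_
      rw [Finset.mem_range] at hb
      omega
  · exact Finset.sum_eq_zero fun b hb => if_neg (by omega)

theorem Mform_zero : Mform 0 = 1 := by simp [Mform]

theorem Mform_one : Mform 1 = X := by simp [Mform]

theorem Mform_add_two (n : ℕ) : Mform (n + 2) = X * (Mform (n + 1) - Mform n) := by
  ext i
  rcases i with _ | i
  · simp [coeff_Mform]
  rw [coeff_X_mul, coeff_sub, coeff_Mform, coeff_Mform, coeff_Mform]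
  rcases lt_trichotomy i (n + 1) with h | rfl | h
  · rw [if_pos (by omega), if_pos (by omega), if_pos (by omega),
      show n + 2 - (i + 1) = n - i + 1 by omega, show n + 1 - i = n - i + 1 by omega,
      Nat.choose_succ_succ]
    push_cast
    ring
  · simp
  · rw [if_neg (by omega), if_neg (by omega), if_neg (by omega), sub_zero]

/-- The coefficient of `X ^ k` in `𝒯(Xⁿ)`. -/
noncomputable def ballot (n k : ℕ) : ℚ :=
  if k ≤ n then (k : ℚ) / ((2 * n - k : ℕ) : ℚ) * (Nat.choose (2 * n - k) (n - k) : ℚ) else 0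

theorem ballot_add (k j : ℕ) :
    ballot (k + j) k = k / (k + 2 * j) * ((k + 2 * j).choose j : ℕ) := by
  rw [ballot, if_pos (by omega), show 2 * (k + j) - k = k + 2 * j by omega,
    show k + j - k = j by omega]
  push_cast
  rfl

theorem ballot_of_lt {n k : ℕ} (h : n < k) : ballot n k = 0 := if_neg (by omega)

theorem ballot_self {n : ℕ} (h : n ≠ 0) : ballot n n = 1 := by
  have := ballot_add n 0
  have h' : (n : ℚ) ≠ 0 := by exact_mod_cast h
  simpa [h'] using this

theorem ballot_succ_succ {n : ℕ} (hn : n ≠ 0) (k : ℕ) :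
    ballot (n + 1) (k + 1) = ballot n k + ballot (n + 1) (k + 2) := by
  rcases lt_trichotomy n k with h | rfl | h
  · simp [ballot_of_lt, h, Nat.lt_succ_of_lt h]
  · rw [ballot_self hn, ballot_self (by omega), ballot_of_lt (by omega), add_zero]
  · obtain ⟨j, rfl⟩ : ∃ j, n = k + (j + 1) := ⟨n - k - 1, by omega⟩
    rw [ballot_add k (j + 1), show k + (j + 1) + 1 = k + 1 + (j + 1) by ring, ballot_add,
      show k + 1 + (j + 1) = k + 2 + j by ring, ballot_add]
    have h₁ := Nat.add_one_mul_choose_eq (k + 2 * j + 2) j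
    have h₂ := Nat.choose_succ_right_eq (k + 2 * j + 2) j
    rw [show k + 2 * j + 2 - j = k + j + 2 by omega] at h₂
    rw [show k + 1 + 2 * (j + 1) = k + 2 * j + 2 + 1 by ring,
      show k + 2 * (j + 1) = k + 2 * j + 2 by ring, show k + 2 + 2 * j = k + 2 * j + 2 by ring]
    have hj : (j + 1 : ℚ) ≠ 0 := by positivity
    have h₁' : (((k + 2 * j + 2 + 1).choose (j + 1) : ℕ) : ℚ)
        = (k + 2 * j + 3) * ((k + 2 * j + 2).choose j : ℕ) / (j + 1) := by
      rw [eq_div_iff hj, show (k + 2 * j + 3 : ℚ) = ((k + 2 * j + 2 + 1 : ℕ) : ℚ) by push_cast; ring]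
      exact_mod_cast h₁.symm
    have h₂' : (((k + 2 * j + 2).choose (j + 1) : ℕ) : ℚ)
        = (k + j + 2) * ((k + 2 * j + 2).choose j : ℕ) / (j + 1) := by
      rw [eq_div_iff hj, mul_comm (k + j + 2 : ℚ)]
      exact_mod_cast h₂
    rw [h₁', h₂']
    have e₁ : (k + 2 * j + 2 : ℚ) ≠ 0 := by positivity
    have e₂ : (k + 2 * j + 3 : ℚ) ≠ 0 := by positivity
    push_cast
    rw [show (k + 1 + 2 * (j + 1) : ℚ) = k + 2 * j + 3 by ring,
      show (k + 2 * (j + 1) : ℚ) = k + 2 * j + 2 by ring,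
      show (k + 2 + 2 * j : ℚ) = k + 2 * j + 2 by ring]
    field_simp
    ring

theorem Tform_eq_sum (n : ℕ) :
    Tform n = ∑ k ∈ Finset.range n, C (ballot n (k + 1)) * X ^ (k + 1) := by
  rw [Tform, ← Finset.Ico_add_one_right_eq_Icc, Finset.sum_Ico_eq_sum_range]
  refine Finset.sum_congr (by simp) fun k hk => ?_
  rw [Finset.mem_range] at hk
  rw [ballot, if_pos (by omega), add_comm 1 k]

theorem X_mul_sum_ballot_mul_Mform {n : ℕ} (hn : n ≠ 0) (K : ℕ) :
    X * ∑ k ∈ Finset.range K, C (ballot n (k + 1)) * Mform (k + 1) =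
      ∑ k ∈ Finset.range (K + 1), C (ballot (n + 1) (k + 1)) * Mform (k + 1) -
        C (ballot (n + 1) (K + 2)) * (X * Mform K) := by
  induction K with
  | zero =>
    have h : ballot n 0 = 0 := by simp [ballot]
    simp [Mform_zero, Mform_one, ballot_succ_succ hn 0, h]
  | succ K ih =>
    rw [Finset.sum_range_succ, mul_add, ih, Finset.sum_range_succ _ (K + 1), Mform_add_two,
      ballot_succ_succ hn (K + 1), C_add]
    ring

theorem sum_ballot_mul_Mform (n : ℕ) :
    ∑ k ∈ Finset.range (n + 1), C (ballot (n + 1) (k + 1)) * Mform (k + 1) = X ^ (n + 1) := by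
  induction n with
  | zero => simp [ballot_self, Mform_one]
  | succ n ih =>
    have h := X_mul_sum_ballot_mul_Mform n.succ_ne_zero (n + 1)
    rw [ih, ballot_of_lt (by omega), C_0, zero_mul, sub_zero] at h
    rw [← h]
    ring

theorem map_comp_eq_id (M T : ℚ[X] →ₗ[ℚ] ℚ[X]) (hM : ∀ n : ℕ, M (X ^ n) = Mform n)
    (hT1 : T 1 = 1) (hTn : ∀ n : ℕ, 1 ≤ n → T (X ^ n) = Tform n) : M ∘ₗ T = LinearMap.id := by
  refine lhom_ext' fun n => LinearMap.ext_ring ?_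
  simp only [LinearMap.comp_apply, monomial_one_right_eq_X_pow, LinearMap.id_apply]
  rcases n with _ | n
  · have := hM 0
    rw [pow_zero] at this ⊢
    rw [hT1, this, Mform_zero]
  · rw [hTn _ (by omega), Tform_eq_sum, map_sum, ← sum_ballot_mul_Mform]
    refine Finset.sum_congr rfl fun k _ => ?_
    rw [← smul_eq_C_mul, map_smul, hM, smul_eq_C_mul]

/-- `polyInv` as a ring homomorphism. -/
noncomputable def polyInvHom : ℚ[X] →+* LaurentSeries ℚ :=
  eval₂RingHom HahnSeries.C (HahnSeries.single (-1) 1)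

theorem polyInv_eq (m : ℚ[X]) : polyInv m = polyInvHom m := by
  rw [polyInv, polyInvHom, coe_eval₂RingHom, eval₂_eq_sum]
  refine Finset.sum_congr rfl fun i _ => ?_
  beta_reduce
  rw [HahnSeries.single_pow, one_pow, HahnSeries.C_apply, HahnSeries.single_mul_single]
  simp

theorem polyInvHom_C (a : ℚ) : polyInvHom (C a) = HahnSeries.C a := by simp [polyInvHom]

theorem polyInvHom_X : polyInvHom X = HahnSeries.single (-1) 1 := by simp [polyInvHom]

theorem truncNonpos_add (f g : LaurentSeries ℚ) :
    truncNonpos (f + g) = truncNonpos f + truncNonpos g := by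
  ext n
  by_cases h : n ≤ 0 <;> simp [truncNonpos, h]

theorem truncNonpos_C_mul (a : ℚ) (f : LaurentSeries ℚ) :
    truncNonpos (HahnSeries.C a * f) = HahnSeries.C a * truncNonpos f := by
  ext n
  rw [HahnSeries.C_mul_eq_smul, HahnSeries.C_mul_eq_smul]
  by_cases h : n ≤ 0 <;> simp [truncNonpos, h]

instance : CharZero (LaurentSeries ℚ) :=
  charZero_of_injective_ringHom HahnSeries.C_injective

theorem div_two_eq_C_mul (f : LaurentSeries ℚ) : f / 2 = HahnSeries.C (1 / 2 : ℚ) * f := by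
  rw [div_eq_iff two_ne_zero, mul_right_comm, ← map_ofNat HahnSeries.C 2, ← map_mul]
  norm_num

theorem truncNonpos_polyInvHom (m : ℚ[X]) : truncNonpos (polyInvHom m) = polyInvHom m := by
  induction m using Polynomial.induction_on' with
  | add p q hp hq => rw [map_add, truncNonpos_add, hp, hq]
  | monomial n a =>
    rw [← polyInv_eq, polyInv, sum_monomial_index _ _ (by simp)]
    ext i
    by_cases h : i ≤ 0
    · simp [truncNonpos, h]
    · have : i ≠ -(n : ℤ) := by omega
      simp [truncNonpos, h, HahnSeries.coeff_single_of_ne this]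

theorem truncNonpos_single_one_mul (p : PowerSeries ℚ) :
    truncNonpos (HahnSeries.single 1 1 * HahnSeries.ofPowerSeries ℤ ℚ p) = 0 := by
  rw [← HahnSeries.ofPowerSeries_X, ← map_mul]
  ext i
  by_cases h : i ≤ 0
  · simp only [truncNonpos, h, if_true, HahnSeries.coeff_zero]
    obtain rfl | h := h.eq_or_lt
    · have := HahnSeries.ofPowerSeries_apply_coeff (Γ := ℤ) (PowerSeries.X * p) 0
      simpa using this
    · rw [HahnSeries.ofPowerSeries_apply]
      refine HahnSeries.embDomain_of_notMem_range ?_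
      rintro ⟨k, hk⟩
      have : (k : ℤ) = i := hk
      omega
  · simp [truncNonpos, h]

theorem hatX_add (p q : ℚ[X]) : hatX (p + q) = hatX p + hatX q := by
  simp only [hatX, polyInv_eq, map_add, add_mul, add_div, truncNonpos_add]
  ring

theorem hatX_C_mul (a : ℚ) (p : ℚ[X]) : hatX (C a * p) = HahnSeries.C a * hatX p := by
  simp only [hatX, polyInv_eq, map_mul, polyInvHom_C, mul_assoc, mul_div_assoc,
    truncNonpos_C_mul]
  ring

/-- The Catalan generating function as a Laurent series in `u`. -/
noncomputable def catalanL : LaurentSeries ℚ :=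
  HahnSeries.ofPowerSeries ℤ ℚ (PowerSeries.catalanSeries.map (Nat.castRingHom ℚ))

theorem catalanL_eq : HahnSeries.single 1 1 * catalanL ^ 2 + 1 = catalanL := by
  have h := congrArg (fun p => HahnSeries.ofPowerSeries ℤ ℚ (p.map (Nat.castRingHom ℚ)))
    PowerSeries.catalanSeries_sq_mul_X_add_one
  simp only [map_add, map_mul, map_pow, PowerSeries.map_X, map_one,
    HahnSeries.ofPowerSeries_X] at h
  rw [mul_comm]
  exact h

theorem sL_eq : sL = 1 - 2 * (HahnSeries.single 1 1 * catalanL) := by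
  have h : sSeries = 1 - 2 * (PowerSeries.X *
      PowerSeries.catalanSeries.map (Nat.castRingHom ℚ)) := by
    rw [sSeries]
    congr 2
    ext n
    rcases n with _ | n
    · simp
    · simp [PowerSeries.coeff_succ_X_mul]
  rw [sL, h, map_sub, map_mul, map_mul, map_one, map_ofNat, HahnSeries.ofPowerSeries_X]
  rfl

theorem single_mul_polyInvHom_X : HahnSeries.single 1 1 * polyInvHom X = 1 := by
  rw [polyInvHom_X, HahnSeries.single_mul_single]
  simp

theorem sL_ne_zero : sL ≠ 0 := by
  intro h
  have h0 := HahnSeries.ofPowerSeries_injective (Γ := ℤ) (h.trans (map_zero _).symm)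
  have := congrArg PowerSeries.constantCoeff h0
  simp [sSeries, PowerSeries.coeff_mul, ← PowerSeries.coeff_zero_eq_constantCoeff_apply,
    -PowerSeries.coeff_zero_eq_constantCoeff] at this

/-- The root `x(1 + s)/2` of `y² - xy + x`, whose conjugate is the Catalan series. -/
noncomputable def rootL : LaurentSeries ℚ := polyInvHom X - catalanL

theorem catalanL_sq : catalanL ^ 2 = polyInvHom X * (catalanL - 1) := by
  linear_combination (-catalanL ^ 2) * single_mul_polyInvHom_X + polyInvHom X * catalanL_eq

theorem rootL_sq : rootL ^ 2 = polyInvHom X * (rootL - 1) := by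
  rw [rootL]
  linear_combination catalanL_sq

theorem polyInvHom_X_mul_sL : polyInvHom X * sL = rootL - catalanL := by
  rw [rootL, sL_eq]
  linear_combination (-2 * catalanL) * single_mul_polyInvHom_X

theorem polyInvHom_Mform_mul (n : ℕ) :
    polyInvHom (Mform n) * (polyInvHom X * sL) = rootL ^ (n + 1) - catalanL ^ (n + 1) := by
  induction n using Nat.twoStepInduction with
  | zero => rw [Mform_zero, map_one, polyInvHom_X_mul_sL]; ring
  | one =>
    rw [Mform_one, polyInvHom_X_mul_sL, rootL]
    ring
  | more n h₀ h₁ =>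
    rw [Mform_add_two, map_mul, map_sub]
    linear_combination polyInvHom X * (h₁ - h₀) - rootL ^ (n + 1) * rootL_sq
      + catalanL ^ (n + 1) * catalanL_sq

theorem exists_polyInvHom_mul (n : ℕ) :
    ∃ p : ℚ[X], polyInvHom p * polyInvHom X = rootL ^ (n + 1) + catalanL ^ (n + 1) := by
  induction n using Nat.twoStepInduction with
  | zero => exact ⟨1, by rw [map_one, rootL]; ring⟩
  | one =>
    refine ⟨X - 2, ?_⟩
    have h : rootL = polyInvHom X - catalanL := rfl
    rw [map_sub, map_ofNat]
    linear_combination -rootL_sq - catalanL_sq - polyInvHom X * h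
  | more n h₀ h₁ =>
    obtain ⟨p, hp⟩ := h₀
    obtain ⟨q, hq⟩ := h₁
    refine ⟨X * (q - p), ?_⟩
    rw [map_mul, map_sub]
    linear_combination polyInvHom X * (hq - hp) - rootL ^ (n + 1) * rootL_sq
      - catalanL ^ (n + 1) * catalanL_sq

theorem hatX_Mform_mul (n : ℕ) :
    hatX (Mform n) * (polyInvHom X * sL) = rootL ^ (n + 1) := by
  obtain ⟨p, hp⟩ := exists_polyInvHom_mul n
  have hM := polyInvHom_Mform_mul n
  have hx := single_mul_polyInvHom_X
  have h : polyInvHom (Mform n) * sL = polyInvHom p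
      + HahnSeries.C (-2) * (HahnSeries.single 1 1 * catalanL ^ (n + 1)) := by
    rw [map_neg, map_ofNat]
    linear_combination HahnSeries.single 1 1 * (hM - hp)
      + (polyInvHom p - polyInvHom (Mform n) * sL) * hx
  have ht : truncNonpos (polyInvHom (Mform n) * sL / 2) = polyInvHom p / 2 := by
    rw [div_two_eq_C_mul, div_two_eq_C_mul, h, truncNonpos_C_mul, truncNonpos_add,
      truncNonpos_C_mul, truncNonpos_polyInvHom, catalanL, ← map_pow, truncNonpos_single_one_mul,
      mul_zero, add_zero]
  rw [hatX, polyInv_eq, ht]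
  have hs := sL_ne_zero
  field_simp
  linear_combination hp + hM

theorem hatX_Mform (n : ℕ) : hatX (Mform n) = rootL ^ n * hatX 1 := by
  have h₀ := hatX_Mform_mul 0
  rw [Mform_zero] at h₀
  have hx : polyInvHom X * sL ≠ 0 :=
    mul_ne_zero (right_ne_zero_of_mul_eq_one single_mul_polyInvHom_X) sL_ne_zero
  refine mul_right_cancel₀ hx ?_
  rw [hatX_Mform_mul, mul_assoc, h₀]
  ring

theorem hatX_map (M : ℚ[X] →ₗ[ℚ] ℚ[X]) (hM : ∀ n : ℕ, M (X ^ n) = Mform n) (p : ℚ[X]) :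
    hatX (M p) = eval₂RingHom HahnSeries.C rootL p * hatX 1 := by
  induction p using Polynomial.induction_on' with
  | add p q hp hq => rw [map_add, hatX_add, hp, hq, map_add, add_mul]
  | monomial n a =>
    rw [← C_mul_X_pow_eq_monomial, ← smul_eq_C_mul, map_smul, hM, smul_eq_C_mul, hatX_C_mul,
      hatX_Mform, smul_eq_C_mul]
    simp [mul_assoc]

/-- For all polynomials `m₁, m₂`, with `m₁ ∧ m₂ = ℳ(𝒯(m₁)·𝒯(m₂))`, one has
`m̂₁ · m̂₂ = (m₁ ∧ m₂)^∧ · 1̂` in `ℚ((u))`. -/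
theorem hatX_mul (M T : Polynomial ℚ →ₗ[ℚ] Polynomial ℚ)
    (hM : ∀ n : ℕ, M (Polynomial.X ^ n) = Mform n)
    (hT1 : T 1 = 1)
    (hTn : ∀ n : ℕ, 1 ≤ n → T (Polynomial.X ^ n) = Tform n)
    (m₁ m₂ : Polynomial ℚ) :
    hatX m₁ * hatX m₂ = hatX (M (T m₁ * T m₂)) * hatX 1 := by
  have hMT (m : ℚ[X]) : M (T m) = m := LinearMap.congr_fun (map_comp_eq_id M T hM hT1 hTn) m
  have hhat (m : ℚ[X]) : hatX m = eval₂RingHom HahnSeries.C rootL (T m) * hatX 1 := by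
    rw [← hatX_map M hM, hMT]
  rw [hatX_map M hM, map_mul, hhat m₁, hhat m₂]
  ring
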